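/- arXiv:math/0112274 — 5 statements merged into one kernel-verified Lean document; each statement's English description precedes it below -/
import Mathlib

section
/- Let T be a strictly singular, injective bounded linear operator on an infinite dimensional Banach space X, let Y be an infinite dimensional closed subspace of X, let F be a finite codimensional closed subspace of X, and let k be a positive integer. Then there exists η₀ ∈ (0,1) such that for every η with 0 < η ≤ η₀ there exists x ∈ Y with ‖x‖ = 1 satisfying: (a) T^{i-1} x ∈ F and ‖T^i x‖ ≤ η ‖T^{i-1} x‖ for i = 1, 2, ..., k+1 (where T^0 is the identity); and (b) bc{x, Tx/‖Tx‖, ..., T^k x/‖T^k x‖} ≤ 1/√η. -/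
/-- A bounded linear operator `T` on a normed space `X` is strictly singular if for every
infinite dimensional closed subspace `Y` of `X`, the restriction of `T` to `Y` is not
bounded below. -/
def StrictlySingular {X : Type*} [NormedAddCommGroup X] [NormedSpace ℝ X]
    (T : X →L[ℝ] X) : Prop :=
  ∀ Y : Submodule ℝ X, IsClosed (Y : Set X) → ¬ FiniteDimensional ℝ Y →
    ¬ ∃ c : ℝ, 0 < c ∧ ∀ y ∈ Y, c * ‖y‖ ≤ ‖T y‖

theorem aux_small {X : Type*} [NormedAddCommGroup X] [NormedSpace ℝ X]
    (T : X →L[ℝ] X) (hT : StrictlySingular T) (W : Submodule ℝ X)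
    (hW : ¬ FiniteDimensional ℝ W) (ε : ℝ) (hε : 0 < ε) :
    ∃ w ∈ W, w ≠ 0 ∧ ‖T w‖ ≤ ε * ‖w‖ := by
  by_contra hcon
  push Not at hcon
  refine hT W.topologicalClosure W.isClosed_topologicalClosure ?_ ⟨ε, hε, ?_⟩
  · intro h
    exact hW (Submodule.finiteDimensional_of_le W.le_topologicalClosure)
  · intro y hy
    have hcl : IsClosed {y : X | ε * ‖y‖ ≤ ‖T y‖} :=
      isClosed_le (by fun_prop) (by fun_prop)
    have hsub : (W : Set X) ⊆ {y : X | ε * ‖y‖ ≤ ‖T y‖} := by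
      intro w hw
      by_cases h0 : w = 0
      · simp [h0]
      · exact (hcon w hw h0).le
    exact closure_minimal hsub hcl hy

theorem aux_ker {X V : Type*} [AddCommGroup X] [Module ℝ X] [AddCommGroup V] [Module ℝ V]
    [FiniteDimensional ℝ V] (Z : Submodule ℝ X) (hZ : ¬ FiniteDimensional ℝ Z)
    (f : X →ₗ[ℝ] V) : ¬ FiniteDimensional ℝ (Z ⊓ LinearMap.ker f : Submodule ℝ X) := by
  intro h
  apply hZ
  have h1 : (Submodule.map f Z).FG := IsNoetherian.noetherian _
  have h2 : (Z ⊓ LinearMap.ker f).FG := Module.Finite.iff_fg.mp h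
  exact Module.Finite.iff_fg.mpr (Submodule.fg_of_fg_map_of_fg_inf_ker f h1 h2)

theorem aux_step {X : Type*} [NormedAddCommGroup X] [NormedSpace ℝ X]
    (T : X →L[ℝ] X) (hT : StrictlySingular T) (hinj : Function.Injective T)
    (Z : Submodule ℝ X) (hZ : ¬ FiniteDimensional ℝ Z) (k i : ℕ)
    (g : ℕ → X →L[ℝ] ℝ) (N δ : ℝ) (hN : 0 < N) (hδ : 0 < δ) :
    ∃ v ∈ Z, (∀ j ≤ k, g j ((T ^ i) v) = 0) ∧ ‖(T ^ i) v‖ = N ∧ ‖(T ^ (i + 1)) v‖ ≤ δ := by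
  have hinj' : Function.Injective (T ^ i) := by
    have hc : ⇑(T ^ i) = T^[i] := by
      ext u
      simp
    rw [hc]
    exact hinj.iterate i
  let f : X →ₗ[ℝ] (Fin (k + 1) → ℝ) :=
    LinearMap.pi fun j => ((g j).comp (T ^ i) : X →L[ℝ] ℝ).toLinearMap
  have hZ' := aux_ker Z hZ f
  set Z' := Z ⊓ LinearMap.ker f with hZ'def
  have hW : ¬ FiniteDimensional ℝ (Z'.map ((T ^ i : X →L[ℝ] X) : X →ₗ[ℝ] X)) := by
    intro h
    apply hZ'
    exact (Submodule.equivMapOfInjective ((T ^ i : X →L[ℝ] X) : X →ₗ[ℝ] X) hinj' Z').symm.finiteDimensional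
  obtain ⟨w, hw, hw0, hTw⟩ := aux_small T hT _ hW (δ / N) (by positivity)
  obtain ⟨u, hu, rfl⟩ := hw
  have hnorm : 0 < ‖(T ^ i) u‖ := norm_pos_iff.mpr hw0
  refine ⟨(N / ‖(T ^ i) u‖) • u, Z.smul_mem _ hu.1, ?_, ?_, ?_⟩
  · intro j hj
    have h1 : f u = 0 := hu.2
    have h2 := congrFun h1 ⟨j, Nat.lt_succ_of_le hj⟩
    have h3 : g j ((T ^ i) u) = 0 := h2
    rw [map_smul, map_smul, h3, smul_zero]
  · rw [map_smul, norm_smul, Real.norm_of_nonneg (by positivity)]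
    field_simp
  · rw [map_smul, norm_smul, Real.norm_of_nonneg (by positivity), pow_succ']
    change N / ‖(T ^ i) u‖ * ‖T ((T ^ i) u)‖ ≤ δ
    calc N / ‖(T ^ i) u‖ * ‖T ((T ^ i) u)‖ ≤ N / ‖(T ^ i) u‖ * (δ / N * ‖(T ^ i) u‖) := by
          gcongr
          exact hTw
      _ = δ := by field_simp

/-- the inductive state -/
def AuxState {X : Type*} [NormedAddCommGroup X] [NormedSpace ℝ X]
    (T : X →L[ℝ] X) (η τ : ℝ) (k i : ℕ) (g : ℕ → X →L[ℝ] ℝ) (y : X) : Prop :=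
  (∀ l, i ≤ l → l ≤ k → ‖(T ^ (l + 1)) y‖ < η * ‖(T ^ l) y‖) ∧
  (∀ j, i ≤ j → j ≤ k → ‖(T ^ j) y‖ / 2 < g j ((T ^ j) y)) ∧
  (∀ j l, i ≤ l → l < j → j ≤ k → |g j ((T ^ l) y)| < τ * ‖(T ^ l) y‖)

theorem aux_open {X : Type*} [NormedAddCommGroup X] [NormedSpace ℝ X]
    (T : X →L[ℝ] X) (η τ : ℝ) (k i : ℕ) (g : ℕ → X →L[ℝ] ℝ) (y : X)
    (h : AuxState T η τ k i g y) :
    ∃ δ > 0, ∀ v, ‖(T ^ i) v‖ ≤ δ → AuxState T η τ k i g (y + v) := by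
  have key : ∀ l, i ≤ l → ∀ v, (T ^ l) (y + v) = (T ^ l) y + (T ^ (l - i)) ((T ^ i) v) := by
    intro l hl v
    rw [map_add]
    congr 1
    rw [← mul_apply_eq_comp, ← pow_add, Nat.sub_add_cancel hl]
  obtain ⟨h1, h2, h3⟩ := h
  have e1 : ∀ᶠ w in nhds (0 : X), ∀ l ∈ Finset.Icc i k,
      ‖(T ^ (l + 1)) y + (T ^ (l + 1 - i)) w‖ < η * ‖(T ^ l) y + (T ^ (l - i)) w‖ := by
    rw [Filter.eventually_all_finset]
    intro l hl
    rw [Finset.mem_Icc] at hl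
    refine ContinuousAt.eventually_lt (by fun_prop) (by fun_prop) ?_
    simpa using h1 l hl.1 hl.2
  have e2 : ∀ᶠ w in nhds (0 : X), ∀ j ∈ Finset.Icc i k,
      ‖(T ^ j) y + (T ^ (j - i)) w‖ / 2 < g j ((T ^ j) y + (T ^ (j - i)) w) := by
    rw [Filter.eventually_all_finset]
    intro l hl
    rw [Finset.mem_Icc] at hl
    refine ContinuousAt.eventually_lt (by fun_prop) (by fun_prop) ?_
    simpa using h2 l hl.1 hl.2
  have e3 : ∀ᶠ w in nhds (0 : X), ∀ j ∈ Finset.Icc i k, ∀ l ∈ Finset.Ico i j,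
      |g j ((T ^ l) y + (T ^ (l - i)) w)| < τ * ‖(T ^ l) y + (T ^ (l - i)) w‖ := by
    rw [Filter.eventually_all_finset]
    intro j hj
    rw [Filter.eventually_all_finset]
    intro l hl
    rw [Finset.mem_Icc] at hj
    rw [Finset.mem_Ico] at hl
    refine ContinuousAt.eventually_lt (by fun_prop) (by fun_prop) ?_
    simpa using h3 j l hl.1 hl.2 hj.2
  obtain ⟨ε, hε, H⟩ := Metric.eventually_nhds_iff.mp (e1.and (e2.and e3))
  refine ⟨ε / 2, by positivity, fun v hv => ?_⟩
  obtain ⟨H1, H2, H3⟩ := H (y := (T ^ i) v) (by rw [dist_zero_right]; linarith)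
  refine ⟨?_, ?_, ?_⟩
  · intro l hl hlk
    rw [key l hl, key (l + 1) (by omega)]
    exact H1 l (Finset.mem_Icc.mpr ⟨hl, hlk⟩)
  · intro j hj hjk
    rw [key j hj]
    exact H2 j (Finset.mem_Icc.mpr ⟨hj, hjk⟩)
  · intro j l hl hlj hjk
    rw [key l hl]
    exact H3 j (Finset.mem_Icc.mpr ⟨by omega, hjk⟩) l (Finset.mem_Ico.mpr ⟨hl, hlj⟩)

theorem aux_ind {X : Type*} [NormedAddCommGroup X] [NormedSpace ℝ X]
    (T : X →L[ℝ] X) (hT : StrictlySingular T) (hinj : Function.Injective T)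
    (Z : Submodule ℝ X) (hZ : ¬ FiniteDimensional ℝ Z) (k : ℕ) (η τ : ℝ)
    (hη : 0 < η) (hτ : 0 < τ) (i : ℕ) (hi : i ≤ k + 1) :
    ∃ y ∈ Z, ∃ g : ℕ → X →L[ℝ] ℝ, (∀ j, ‖g j‖ ≤ 1) ∧ AuxState T η τ k i g y := by
  induction hi using Nat.decreasingInduction with
  | self =>
    exact ⟨0, Z.zero_mem, fun _ => 0, by simp, by intros; omega, by intros; omega,
      by intros; omega⟩
  | of_succ i hi ih =>
    obtain ⟨y, hy, g, hg, hs⟩ := ih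
    obtain ⟨δ, hδ, hopen⟩ := aux_open T η τ k (i + 1) g y hs
    set R := ‖(T ^ i) y‖ with hR
    set Q := ‖(T ^ (i + 1)) y‖ + δ with hQ
    have hR0 : 0 ≤ R := norm_nonneg _
    have hQ0 : 0 < Q := by positivity
    obtain ⟨v, hv, hgv, hvN, hvδ⟩ := aux_step T hT hinj Z hZ k i g (R + Q / η + R / τ + 1) δ
      (by positivity) hδ
    obtain ⟨h1, h2, h3⟩ := hopen v hvδ
    have hlow : Q / η + R / τ + 1 ≤ ‖(T ^ i) (y + v)‖ := by
      rw [map_add]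
      have := norm_sub_le ((T ^ i) y + (T ^ i) v) ((T ^ i) y)
      rw [add_sub_cancel_left] at this
      linarith
    have hQη : 0 < Q / η := by positivity
    have hRτ : 0 ≤ R / τ := by positivity
    obtain ⟨φ, hφ, hφv⟩ := exists_dual_vector'' ℝ ((T ^ i) (y + v))
    have hφv' : φ ((T ^ i) (y + v)) = ‖(T ^ i) (y + v)‖ := by simpa using hφv
    refine ⟨y + v, Z.add_mem hy hv, Function.update g i φ, ?_, ?_, ?_, ?_⟩
    · intro j
      by_cases hj : j = i
      · subst hj; simpa using hφ
      · simpa [hj] using hg j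
    · intro l hl hlk
      rcases Nat.eq_or_lt_of_le hl with rfl | hl
      · have hup : ‖(T ^ (i + 1)) (y + v)‖ ≤ Q := by
          rw [map_add]
          exact (norm_add_le _ _).trans (by linarith)
        have : Q < η * ‖(T ^ i) (y + v)‖ := by
          rw [← div_lt_iff₀' hη]
          linarith
        linarith
      · exact h1 l hl hlk
    · intro j hj hjk
      rcases Nat.eq_or_lt_of_le hj with rfl | hj
      · rw [Function.update_self, hφv']
        linarith
      · rw [Function.update_of_ne (by omega)]
        exact h2 j hj hjk
    · intro j l hl hlj hjk
      rw [Function.update_of_ne (by omega)]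
      rcases Nat.eq_or_lt_of_le hl with rfl | hl
      · have e : g j ((T ^ i) (y + v)) = g j ((T ^ i) y) := by
          rw [map_add, map_add, hgv j hjk, add_zero]
        rw [e]
        have b : |g j ((T ^ i) y)| ≤ R := by
          have := (g j).le_of_opNorm_le (hg j) ((T ^ i) y)
          rwa [one_mul, Real.norm_eq_abs] at this
        have : R < τ * ‖(T ^ i) (y + v)‖ := by
          rw [← div_lt_iff₀' hτ]
          linarith
        linarith
      · exact h3 j l hl hlj hjk

theorem aux_rec (k : ℕ) (a : ℕ → ℝ) (B : ℝ)
    (h : ∀ j ≤ k, a j ≤ 2 * (B + ∑ l ∈ Finset.Ioc j k, a l)) (j : ℕ) (hj : j ≤ k) :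
    B + ∑ l ∈ Finset.Ioc j k, a l ≤ 3 ^ (k - j) * B := by
  induction hj using Nat.decreasingInduction with
  | self => simp
  | of_succ j hj ih =>
    have e : ∑ l ∈ Finset.Ioc j k, a l = a (j + 1) + ∑ l ∈ Finset.Ioc (j + 1) k, a l := by
      have hset : Finset.Ioc j k = insert (j + 1) (Finset.Ioc (j + 1) k) := by
        ext l
        simp only [Finset.mem_insert, Finset.mem_Ioc]
        omega
      rw [hset, Finset.sum_insert (by simp)]
    have h1 := h (j + 1) hj
    have e2 : k - j = (k - (j + 1)) + 1 := by omega
    rw [e, e2, pow_succ]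
    linarith

theorem aux_final {X : Type*} [NormedAddCommGroup X] [NormedSpace ℝ X]
    (k : ℕ) (τ : ℝ) (hτ : τ = 1 / ((k + 1) * (4 * 3 ^ k))) (g : ℕ → X →L[ℝ] ℝ)
    (hg : ∀ j, ‖g j‖ ≤ 1) (e : ℕ → X) (he : ∀ j ≤ k, ‖e j‖ = 1)
    (h2 : ∀ j ≤ k, 1 / 2 ≤ g j (e j)) (h3 : ∀ j l, l < j → j ≤ k → |g j (e l)| ≤ τ)
    (α : ℕ → ℝ) (hα : ‖∑ l ∈ Finset.range (k + 1), α l • e l‖ = 1) :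
    ∀ j ≤ k, |α j| ≤ 4 * 3 ^ k := by
  obtain ⟨m, hm, hmax⟩ := Finset.exists_max_image (Finset.range (k + 1)) (fun l => |α l|)
    ⟨0, by simp⟩
  have hmk : m ≤ k := by simpa [Nat.lt_succ_iff] using hm
  set A := |α m| with hA
  have hA0 : 0 ≤ A := abs_nonneg _
  have hτ0 : 0 < τ := by rw [hτ]; positivity
  have hrec : ∀ j ≤ k, |α j| ≤ 2 * ((1 + (k + 1) * (τ * A)) + ∑ l ∈ Finset.Ioc j k, |α l|) := by
    intro j hj
    have hjm : j ∈ Finset.range (k + 1) := by simp; omega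
    have hs : |g j (∑ l ∈ Finset.range (k + 1), α l • e l)| ≤ 1 := by
      have := (g j).le_of_opNorm_le (hg j) (∑ l ∈ Finset.range (k + 1), α l • e l)
      rw [hα] at this
      simpa using this
    rw [map_sum, ← Finset.add_sum_erase _ _ hjm] at hs
    have hb : |∑ l ∈ (Finset.range (k + 1)).erase j, g j (α l • e l)| ≤
        (k + 1) * (τ * A) + ∑ l ∈ Finset.Ioc j k, |α l| := by
      calc _ ≤ ∑ l ∈ (Finset.range (k + 1)).erase j, |g j (α l • e l)| :=
            Finset.abs_sum_le_sum_abs _ _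
        _ ≤ ∑ l ∈ (Finset.range (k + 1)).erase j, (τ * A + if j < l then |α l| else 0) := by
            apply Finset.sum_le_sum
            intro l hl
            simp only [Finset.mem_erase, Finset.mem_range] at hl
            have hlA : |α l| ≤ A := hmax l (by simp; omega)
            rw [map_smul, smul_eq_mul, abs_mul]
            split_ifs with hjl
            · have := (g j).le_of_opNorm_le (hg j) (e l)
              rw [he l (by omega), Real.norm_eq_abs] at this
              have h5 : |α l| * |g j (e l)| ≤ |α l| * 1 := by gcongr; linarith
              have : 0 ≤ τ * A := by positivity
              linarith
            · have := h3 j l (by omega) hj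
              have h5 : |α l| * |g j (e l)| ≤ A * τ := by gcongr
              linarith
        _ ≤ ∑ l ∈ (Finset.range (k + 1)), (τ * A + if j < l then |α l| else 0) := by
            apply Finset.sum_le_sum_of_subset_of_nonneg (Finset.erase_subset _ _)
            intro l _ _
            split_ifs <;> positivity
        _ = _ := by
            rw [Finset.sum_add_distrib, ← Finset.sum_filter]
            congr 1
            · simp
            · congr 1
              ext l
              simp
              omega
    have h4 : |g j (α j • e j)| ≤ 1 + ((k + 1) * (τ * A) + ∑ l ∈ Finset.Ioc j k, |α l|) := by
      have := abs_sub (g j (α j • e j) + ∑ l ∈ (Finset.range (k + 1)).erase j, g j (α l • e l))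
        (∑ l ∈ (Finset.range (k + 1)).erase j, g j (α l • e l))
      rw [add_sub_cancel_right] at this
      linarith
    rw [map_smul, smul_eq_mul, abs_mul] at h4
    have h5 : |α j| * (1 / 2) ≤ |α j| * |g j (e j)| := by
      gcongr
      exact (h2 j hj).trans (le_abs_self _)
    linarith
  have hAb := hrec m hmk
  have h6 := aux_rec k (fun l => |α l|) _ hrec m hmk
  have h7 : (3 : ℝ) ^ (k - m) ≤ 3 ^ k := pow_le_pow_right₀ (by norm_num) (by omega)
  have h8 : (3 : ℝ) ^ (k - m) * (1 + (k + 1) * (τ * A)) ≤ 3 ^ k * (1 + (k + 1) * (τ * A)) := by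
    gcongr
  have h9 : (3 : ℝ) ^ k * ((k + 1) * (τ * A)) = A / 4 := by
    rw [hτ]; field_simp
  have hA' : A ≤ 4 * 3 ^ k := by
    have : A ≤ 2 * (3 ^ k + A / 4) := by
      rw [← h9]
      linarith
    linarith
  intro j hj
  exact (hmax j (by simp; omega)).trans hA'

theorem stmt_1 {X : Type*} [NormedAddCommGroup X] [NormedSpace ℝ X] [CompleteSpace X]
    (hX : ¬ FiniteDimensional ℝ X) (T : X →L[ℝ] X)
    (hT : StrictlySingular T) (hinj : Function.Injective T)
    (Y : Submodule ℝ X) (hYc : IsClosed (Y : Set X)) (hY : ¬ FiniteDimensional ℝ Y)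
    (F : Submodule ℝ X) (hFc : IsClosed (F : Set X)) (hF : FiniteDimensional ℝ (X ⧸ F))
    (k : ℕ) (hk : 0 < k) :
    ∃ η₀ ∈ Set.Ioo (0 : ℝ) 1, ∀ η : ℝ, 0 < η → η ≤ η₀ →
      ∃ x ∈ Y, ‖x‖ = 1 ∧
        (∀ i, 1 ≤ i → i ≤ k + 1 →
          (T ^ (i - 1)) x ∈ F ∧ ‖(T ^ i) x‖ ≤ η * ‖(T ^ (i - 1)) x‖) ∧
        (∀ α : Fin (k + 1) → ℝ,
          ‖∑ i, α i • (‖(T ^ (i : ℕ)) x‖⁻¹ • (T ^ (i : ℕ)) x)‖ = 1 →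
          ∀ i, |α i| ≤ 1 / Real.sqrt η) := by
  have h3k : (1 : ℝ) ≤ 3 ^ k := one_le_pow₀ (by norm_num)
  refine ⟨1 / (4 * 3 ^ k) ^ 2, ⟨by positivity, ?_⟩, ?_⟩
  · rw [div_lt_one (by positivity)]
    nlinarith
  intro η hη hη0
  let f : X →ₗ[ℝ] (Fin (k + 1) → X ⧸ F) :=
    LinearMap.pi fun j => F.mkQ ∘ₗ ((T ^ (j : ℕ) : X →L[ℝ] X) : X →ₗ[ℝ] X)
  have hZ := aux_ker Y hY f
  obtain ⟨y, hy, g, hg, h1, h2, h3⟩ := aux_ind T hT hinj _ hZ k η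
    (1 / ((k + 1) * (4 * 3 ^ k))) hη (by positivity) 0 (by omega)
  have hpos : ∀ l ≤ k, 0 < ‖(T ^ l) y‖ := by
    intro l hl
    have := (norm_nonneg _).trans_lt (h1 l (by omega) hl)
    exact pos_of_mul_pos_right this hη.le
  have hy0 : 0 < ‖y‖ := by simpa using hpos 0 (by omega)
  have hsc : ∀ l, ‖(T ^ l) (‖y‖⁻¹ • y)‖ = ‖y‖⁻¹ * ‖(T ^ l) y‖ := by
    intro l
    rw [map_smul, norm_smul, norm_inv, norm_norm]
  have hdir : ∀ l, ‖(T ^ l) (‖y‖⁻¹ • y)‖⁻¹ • (T ^ l) (‖y‖⁻¹ • y)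
      = ‖(T ^ l) y‖⁻¹ • (T ^ l) y := by
    intro l
    rw [hsc, map_smul, smul_smul]
    congr 1
    field_simp
  refine ⟨‖y‖⁻¹ • y, Y.smul_mem _ hy.1, ?_, ?_, ?_⟩
  · rw [norm_smul, norm_inv, norm_norm]
    field_simp
  · intro i hi hik
    obtain ⟨i, rfl⟩ : ∃ n, i = n + 1 := ⟨i - 1, by omega⟩
    rw [Nat.add_sub_cancel]
    constructor
    · rw [map_smul]
      apply F.smul_mem
      have hfy : f y = 0 := hy.2
      have := congrFun hfy ⟨i, by omega⟩
      exact (Submodule.Quotient.mk_eq_zero F).mp this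
    · rw [hsc, hsc]
      have := (h1 i (by omega) (by omega)).le
      calc _ ≤ ‖y‖⁻¹ * (η * ‖(T ^ i) y‖) := by gcongr
        _ = _ := by ring
  · intro α hα i
    simp_rw [hdir] at hα
    let α' : ℕ → ℝ := fun l => if h : l < k + 1 then α ⟨l, h⟩ else 0
    have hα' : ‖∑ l ∈ Finset.range (k + 1), α' l • (‖(T ^ l) y‖⁻¹ • (T ^ l) y)‖ = 1 := by
      rw [Finset.sum_range, ← hα]
      congr 1
      apply Finset.sum_congr rfl
      intro l _
      simp only [α', l.isLt, dif_pos, Fin.eta]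
    have := aux_final k _ rfl g hg (fun l => ‖(T ^ l) y‖⁻¹ • (T ^ l) y) ?_ ?_ ?_ α' hα' i
      (by omega)
    · have hi : α' i = α i := by simp only [α', i.isLt, dif_pos, Fin.eta]
      rw [hi] at this
      refine this.trans ?_
      rw [le_div_iff₀ (Real.sqrt_pos.mpr hη), ← le_div_iff₀' (by positivity)]
      apply Real.sqrt_le_iff.mpr
      refine ⟨by positivity, ?_⟩
      rw [div_pow, one_pow]
      exact hη0
    · intro j hj
      have := hpos j hj
      rw [norm_smul, norm_inv, norm_norm]
      field_simp
    · intro j hj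
      have h0 := hpos j hj
      have := h2 j (by omega) hj
      simp only [map_smul, smul_eq_mul]
      rw [inv_mul_eq_div, le_div_iff₀ h0]
      linarith
    · intro j l hl hj
      have h0 := hpos l (by omega)
      have := h3 j l (by omega) hl hj
      simp only [map_smul, smul_eq_mul]
      rw [abs_mul, abs_inv, abs_norm, inv_mul_eq_div, div_le_iff₀ h0]
      exact this.le
end

section
/- A bounded linear operator T on an infinite dimensional Banach space X is strictly singular if and only if for every infinite dimensional closed subspace Y of X there exists an infinite dimensional closed subspace Z of Y such that the restriction of T to Z, T|_Z : Z → X, is a compact operator. -/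
open Filter Topology

lemma infdim_inf_ker {X : Type*} [NormedAddCommGroup X] [NormedSpace ℝ X]
    (Y : Submodule ℝ X) (hY : IsClosed (Y : Set X)) (hfd : ¬ FiniteDimensional ℝ Y)
    (s : Finset (X →L[ℝ] ℝ)) :
    ∃ W : Submodule ℝ X, W ≤ Y ∧ IsClosed (W : Set X) ∧ ¬ FiniteDimensional ℝ W ∧
      ∀ f ∈ s, ∀ w ∈ W, f w = 0 := by
  classical
  induction s using Finset.induction_on with
  | empty => exact ⟨Y, le_rfl, hY, hfd, by simp⟩
  | insert f s _ ih =>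
    obtain ⟨W, hWY, hWc, hWf, hW⟩ := ih
    refine ⟨W ⊓ LinearMap.ker (f : X →ₗ[ℝ] ℝ), inf_le_left.trans hWY, ?_, ?_, ?_⟩
    · rw [Submodule.coe_inf]
      exact hWc.inter f.isClosed_ker
    · intro h
      apply hWf
      have h2 : (W ⊓ LinearMap.ker (f : X →ₗ[ℝ] ℝ)).FG := (Submodule.fg_iff_finiteDimensional _).2 h
      have h1 : (W.map (f : X →ₗ[ℝ] ℝ)).FG := (Submodule.fg_iff_finiteDimensional _).2 inferInstance
      exact (Submodule.fg_iff_finiteDimensional _).1 (Submodule.fg_of_fg_map_of_fg_inf_ker _ h1 h2)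
    · intro g hg w hw
      rcases Finset.mem_insert.1 hg with rfl | hg
      · exact hw.2
      · exact hW g hg w hw.1

lemma exists_small {X : Type*} [NormedAddCommGroup X] [NormedSpace ℝ X]
    (T : X →L[ℝ] X) (hT : StrictlySingular T) (W : Submodule ℝ X) (hW : IsClosed (W : Set X))
    (hfd : ¬ FiniteDimensional ℝ W) (ε : ℝ) (hε : 0 < ε) :
    ∃ z ∈ W, ‖z‖ = 1 ∧ ‖T z‖ ≤ ε := by
  have h := hT W hW hfd
  push Not at h
  obtain ⟨y, hy, hlt⟩ := h ε hε
  have hy0 : 0 < ‖y‖ := by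
    by_contra h0
    have : y = 0 := by simpa using h0
    simp [this] at hlt
  refine ⟨‖y‖⁻¹ • y, W.smul_mem _ hy, ?_, ?_⟩
  · rw [norm_smul, norm_inv, norm_norm, inv_mul_cancel₀ hy0.ne']
  · rw [map_smul, norm_smul, norm_inv, norm_norm, inv_mul_le_iff₀ hy0]
    linarith

lemma exists_seqs {X : Type*} [NormedAddCommGroup X] [NormedSpace ℝ X]
    (T : X →L[ℝ] X) (hT : StrictlySingular T) (Y : Submodule ℝ X) (hY : IsClosed (Y : Set X))
    (hfd : ¬ FiniteDimensional ℝ Y) :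
    ∃ (z : ℕ → X) (f : ℕ → X →L[ℝ] ℝ), (∀ n, z n ∈ Y) ∧ (∀ n, ‖z n‖ = 1) ∧
      (∀ n, ‖T (z n)‖ ≤ (1/4 : ℝ)^n) ∧ (∀ n, ‖f n‖ = 1) ∧ (∀ n, f n (z n) = 1) ∧
      ∀ m n, m < n → f m (z n) = 0 := by
  classical
  obtain ⟨F, hP, hr⟩ := exists_seq_of_forall_finset_exists
    (α := X × (X →L[ℝ] ℝ) × ℕ)
    (fun p => p.1 ∈ Y ∧ ‖p.1‖ = 1 ∧ ‖T p.1‖ ≤ (1/4 : ℝ)^p.2.2 ∧ ‖p.2.1‖ = 1 ∧ p.2.1 p.1 = 1)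
    (fun p q => p.2.1 q.1 = 0 ∧ p.2.2 < q.2.2) (by
      intro s _
      obtain ⟨W, hWY, hWc, hWf, hW⟩ := infdim_inf_ker Y hY hfd (s.image (fun p => p.2.1))
      set k := s.sup (fun p => p.2.2) + 1 with hk
      obtain ⟨z, hz, hz1, hzT⟩ := exists_small T hT W hWc hWf ((1/4 : ℝ)^k) (by positivity)
      obtain ⟨g, hg1, hg⟩ := exists_dual_vector ℝ z (by rw [hz1]; exact one_ne_zero)
      refine ⟨(z, g, k), ⟨hWY hz, hz1, hzT, hg1, by simp [hg, hz1]⟩, ?_⟩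
      intro p hp
      refine ⟨hW _ (Finset.mem_image_of_mem _ hp) z hz, ?_⟩
      exact Nat.lt_succ_of_le (Finset.le_sup (f := fun p : X × (X →L[ℝ] ℝ) × ℕ => p.2.2) hp))
  have hmono : StrictMono (fun n => (F n).2.2) := fun m n h => (hr m n h).2
  refine ⟨fun n => (F n).1, fun n => (F n).2.1, fun n => (hP n).1, fun n => (hP n).2.1, ?_,
    fun n => (hP n).2.2.2.1, fun n => (hP n).2.2.2.2, fun m n h => (hr m n h).1⟩
  intro n
  refine (hP n).2.2.1.trans ?_
  exact pow_le_pow_of_le_one (by norm_num) (by norm_num) (hmono.le_apply (x := n))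

noncomputable def biorth {X : Type*} [NormedAddCommGroup X] [NormedSpace ℝ X]
    (z : ℕ → X) (f : ℕ → X →L[ℝ] ℝ) (n : ℕ) : X →L[ℝ] ℝ :=
  f n - ∑ i : Fin n, f n (z i) • biorth z f i
termination_by n
decreasing_by exact i.2

lemma biorth_eq {X : Type*} [NormedAddCommGroup X] [NormedSpace ℝ X]
    (z : ℕ → X) (f : ℕ → X →L[ℝ] ℝ) (n : ℕ) :
    biorth z f n = f n - ∑ i ∈ Finset.range n, f n (z i) • biorth z f i := by
  rw [biorth, Finset.sum_range (fun i => f n (z i) • biorth z f i)]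

lemma biorth_norm {X : Type*} [NormedAddCommGroup X] [NormedSpace ℝ X]
    (z : ℕ → X) (f : ℕ → X →L[ℝ] ℝ) (hz : ∀ n, ‖z n‖ = 1) (hf : ∀ n, ‖f n‖ = 1) (n : ℕ) :
    ‖biorth z f n‖ ≤ 2^n := by
  induction n using Nat.strong_induction_on with
  | _ n ih =>
    rw [biorth_eq]
    have h1 : ‖∑ i ∈ Finset.range n, f n (z i) • biorth z f i‖ ≤
        ∑ i ∈ Finset.range n, (2:ℝ)^i := by
      refine norm_sum_le_of_le _ fun i hi => ?_
      rw [norm_smul]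
      have h2 : ‖f n (z i)‖ ≤ 1 := by
        simpa [hz, hf] using (f n).le_opNorm (z i)
      have h3 := ih i (Finset.mem_range.1 hi)
      calc _ ≤ 1 * (2:ℝ)^i := mul_le_mul h2 h3 (norm_nonneg _) zero_le_one
        _ = _ := one_mul _
    rw [geom_sum_eq (by norm_num)] at h1
    have := norm_sub_le (f n) (∑ i ∈ Finset.range n, f n (z i) • biorth z f i)
    rw [hf n] at this
    norm_num at h1
    linarith

lemma biorth_apply {X : Type*} [NormedAddCommGroup X] [NormedSpace ℝ X]
    (z : ℕ → X) (f : ℕ → X →L[ℝ] ℝ) (h1 : ∀ n, f n (z n) = 1)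
    (h0 : ∀ m n, m < n → f m (z n) = 0) (n m : ℕ) :
    biorth z f n (z m) = if n = m then 1 else 0 := by
  induction n using Nat.strong_induction_on with
  | _ n ih =>
    rw [biorth_eq]
    have : (∑ i ∈ Finset.range n, f n (z i) • biorth z f i) (z m) =
        ∑ i ∈ Finset.range n, if i = m then f n (z i) else 0 := by
      rw [ContinuousLinearMap.sum_apply]
      refine Finset.sum_congr rfl fun i hi => ?_
      simp [ih i (Finset.mem_range.1 hi)]
    rw [ContinuousLinearMap.sub_apply, this, Finset.sum_ite_eq']
    rcases lt_trichotomy n m with h | h | h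
    · simp [h0 n m h, h.ne, h.le]
    · subst h; simp [h1]
    · simp [h, h.ne']

lemma forward_dir {X : Type*} [NormedAddCommGroup X] [NormedSpace ℝ X] [CompleteSpace X]
    (T : X →L[ℝ] X) (hT : StrictlySingular T) (Y : Submodule ℝ X) (hY : IsClosed (Y : Set X))
    (hfd : ¬ FiniteDimensional ℝ Y) :
    ∃ Z : Submodule ℝ X, Z ≤ Y ∧ IsClosed (Z : Set X) ∧ ¬ FiniteDimensional ℝ Z ∧
          IsCompactOperator (T.comp Z.subtypeL) := by
  obtain ⟨z, f, hzY, hz1, hzT, hf1, hfz, hf0⟩ := exists_seqs T hT Y hY hfd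
  have hgn := biorth_norm z f hz1 hf1
  have hgz := biorth_apply z f hfz hf0
  generalize biorth z f = g at hgn hgz
  set Z := (Submodule.span ℝ (Set.range z)).topologicalClosure with hZ
  have hzZ : ∀ n, z n ∈ Z := fun n =>
    Submodule.le_topologicalClosure _ (Submodule.subset_span ⟨n, rfl⟩)
  refine ⟨Z, ?_, Submodule.isClosed_topologicalClosure _, ?_, ?_⟩
  · refine Submodule.topologicalClosure_minimal _ (Submodule.span_le.2 ?_) hY
    rintro _ ⟨n, rfl⟩; exact hzY n
  · intro hfin
    have hli : LinearIndependent ℝ (fun n => (⟨z n, hzZ n⟩ : Z)) := by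
      rw [linearIndependent_iff']
      intro s a ha i hi
      have h2 := congrArg (fun w : Z => g i (w : X)) ha
      simpa [hgz, hi] using h2
    have := hli.finite
    exact not_finite ℕ
  · have hsum : Summable (fun n => (g n).smulRight (T (z n))) := by
      refine Summable.of_norm_bounded (g := fun n => (1/2 : ℝ)^n)
        (summable_geometric_of_lt_one (by norm_num) (by norm_num)) fun n => ?_
      rw [ContinuousLinearMap.norm_smulRight_apply]
      calc _ ≤ (2:ℝ)^n * (1/4 : ℝ)^n := mul_le_mul (hgn n) (hzT n) (norm_nonneg _) (by positivity)
        _ = _ := by rw [← mul_pow]; norm_num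
    obtain ⟨S, hS⟩ := hsum
    have hSc : IsCompactOperator S := by
      refine isCompactOperator_of_tendsto hS.tendsto_sum_nat (Eventually.of_forall fun n => ?_)
      have h := (compactOperator (RingHom.id ℝ) X X).sum_mem (t := Finset.range n)
        (f := fun n => (g n).smulRight (T (z n))) (by
          intro i _
          have h1 : IsCompactOperator (g i) := isCompactOperator_of_locallyCompactSpace_dom (g i)
          exact h1.continuous_comp (g := fun c : ℝ => c • T (z i)) (by fun_prop))
      exact h
    have hEq : Set.EqOn S T (Set.range z) := by
      rintro _ ⟨m, rfl⟩
      have h1 : HasSum (fun n => ((g n).smulRight (T (z n))) (z m)) (S (z m)) :=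
        hS.mapL (ContinuousLinearMap.apply ℝ X (z m))
      have h2 : HasSum (fun n => ((g n).smulRight (T (z n))) (z m)) (T (z m)) := by
        convert hasSum_ite_eq m (T (z m)) using 2 with n
        by_cases h : n = m
        · subst h; simp [hgz]
        · simp [hgz, h]
      exact h1.unique h2
    have hEq2 := ContinuousLinearMap.eqOn_closure_span hEq
    have h3 : T.comp Z.subtypeL = S.comp Z.subtypeL := by
      ext w
      exact (hEq2 w.2).symm
    rw [h3]
    exact hSc.comp_clm Z.subtypeL

theorem stmt_6 {X : Type*} [NormedAddCommGroup X] [NormedSpace ℝ X] [CompleteSpace X]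
    (hX : ¬ FiniteDimensional ℝ X) (T : X →L[ℝ] X) :
    StrictlySingular T ↔
      ∀ Y : Submodule ℝ X, IsClosed (Y : Set X) → ¬ FiniteDimensional ℝ Y →
        ∃ Z : Submodule ℝ X, Z ≤ Y ∧ IsClosed (Z : Set X) ∧ ¬ FiniteDimensional ℝ Z ∧
          IsCompactOperator (T.comp Z.subtypeL) := by
  refine ⟨fun hT Y hY hfd => forward_dir T hT Y hY hfd, ?_⟩
  rintro h Y hY hfd ⟨c, hc, hb⟩
  obtain ⟨Z, hZY, hZc, hZf, K, hK, hKn⟩ := h Y hY hfd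
  have : CompleteSpace Z := hZc.completeSpace_coe
  have ha : AntilipschitzWith (⟨c⁻¹, by positivity⟩ : NNReal) (T.comp Z.subtypeL) := by
    refine AddMonoidHomClass.antilipschitz_of_bound _ fun x => ?_
    change ‖x‖ ≤ c⁻¹ * ‖T x‖
    rw [le_inv_mul_iff₀ hc]
    exact hb x (hZY x.2)
  have hemb := ha.isClosedEmbedding (T.comp Z.subtypeL).uniformContinuous
  exact hZf (.of_totallyBounded_nhds_zero ℝ hKn (hemb.isCompact_preimage hK).totallyBounded)
end

section
/- Let X be a Banach space, T a bounded linear operator on X, and (Z_n)_{n∈ℕ} a sequence of finite dimensional subspaces of X whose algebraic span Z̃ = span(⋃_n Z_n) is their algebraic direct sum (every x ∈ Z̃ has a unique decomposition x = Σ_n x_n with x_n ∈ Z_n and all but finitely many x_n = 0). Suppose that for every x ∈ Z̃ with ‖x‖ = 1, the components of its decomposition satisfy ‖T x_n‖ < 1/2^n for all n ∈ ℕ. Then the restriction of T to the closure Z of Z̃, T|_Z : Z → X, is a compact operator. -/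
theorem stmt_12 {X : Type*} [NormedAddCommGroup X] [NormedSpace ℝ X] [CompleteSpace X]
    (T : X →L[ℝ] X) (Z : ℕ → Submodule ℝ X)
    (hfd : ∀ n, FiniteDimensional ℝ (Z n))
    (hindep : iSupIndep Z)
    (hnorm : ∀ (x : ℕ → X) (s : Finset ℕ), (∀ n, x n ∈ Z n) → (∀ n ∉ s, x n = 0) →
      ‖∑ n ∈ s, x n‖ = 1 → ∀ n, ‖T (x n)‖ < 1 / 2 ^ n) :
    IsCompactOperator (T.comp (⨆ n, Z n).topologicalClosure.subtypeL) := by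
  let W : ℕ → Submodule ℝ X := fun n => (Z n).map (T : X →ₗ[ℝ] X)
  let K : ℕ → Set X := fun n => Subtype.val '' (Metric.closedBall (0 : W n) (1 / 2 ^ n))
  have hK : ∀ n, IsCompact (K n) := by
    intro n
    have : FiniteDimensional ℝ (W n) := by
      have := hfd n
      infer_instance
    have : ProperSpace (W n) := FiniteDimensional.proper_real (W n)
    exact (isCompact_closedBall _ _).image continuous_subtype_val
  have hKmem : ∀ n y, y ∈ Z n → ‖T y‖ ≤ 1 / 2 ^ n → T y ∈ K n := by
    intro n y hy h
    refine ⟨⟨T y, Submodule.mem_map_of_mem (f := (T : X →ₗ[ℝ] X)) hy⟩, ?_, rfl⟩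
    simpa [Metric.mem_closedBall, dist_zero_right] using h
  let P : Set (ℕ → X) := Set.univ.pi K
  have hP : IsCompact P := isCompact_univ_pi hK
  have hcont : ContinuousOn (fun y : ℕ → X => ∑' n, y n) P := by
    refine continuousOn_tsum (u := fun n : ℕ => (1 / 2 : ℝ) ^ n)
      (fun i => (continuous_apply i).continuousOn) summable_geometric_two ?_
    intro n y hy
    obtain ⟨w, hw, hwy⟩ := hy n (Set.mem_univ n)
    rw [← hwy, one_div_pow]
    simpa [Metric.mem_closedBall, dist_zero_right] using hw
  have hC : IsCompact ((fun y : ℕ → X => ∑' n, y n) '' P) := hP.image_of_continuousOn hcont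
  set C := (fun y : ℕ → X => ∑' n, y n) '' P with hCdef
  have key : ∀ x ∈ (⨆ n, Z n), ‖x‖ < 1 → T x ∈ C := by
    intro x hx hx1
    obtain ⟨f, hf, hfx⟩ := (Submodule.mem_iSup_iff_exists_finsupp Z x).1 hx
    have hsum : ∑ n ∈ f.support, f n = x := hfx
    by_cases h0 : x = 0
    · refine ⟨fun _ => 0, fun n _ => ?_, by simp [h0]⟩
      have := hKmem n 0 (Z n).zero_mem (by simp)
      simpa using this
    · have hpos : 0 < ‖x‖ := norm_pos_iff.2 h0
      have hb := hnorm (fun n => ‖x‖⁻¹ • f n) f.support (fun n => (Z n).smul_mem _ (hf n))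
        (fun n hn => by simp [Finsupp.notMem_support_iff.1 hn])
        (by rw [← Finset.smul_sum, hsum, norm_smul, norm_inv, norm_norm,
              inv_mul_cancel₀ hpos.ne'])
      refine ⟨fun n => T (f n), fun n _ => hKmem n _ (hf n) ?_, ?_⟩
      · have h1 := (hb n).le
        rw [map_smul, norm_smul, norm_inv, norm_norm] at h1
        refine le_trans ?_ h1
        exact le_mul_of_one_le_left (norm_nonneg _) ((one_le_inv₀ hpos).2 hx1.le)
      · change ∑' n, T (f n) = T x
        rw [tsum_eq_sum (s := f.support)
          (fun n hn => by simp [Finsupp.notMem_support_iff.1 hn]), ← map_sum, hsum]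
  refine (isCompactOperator_iff_exists_mem_nhds_image_subset_compact _).2
    ⟨Metric.ball 0 1, Metric.ball_mem_nhds _ one_pos, C, hC, ?_⟩
  rintro _ ⟨z, hz, rfl⟩
  have hz1 : (z : X) ∈ Metric.ball (0 : X) 1 := by
    simpa [Metric.mem_ball, dist_zero_right] using hz
  have hz2 : (z : X) ∈ closure ((⨆ n, Z n : Submodule ℝ X) : Set X) := z.2
  have hz3 := Metric.isOpen_ball.inter_closure ⟨hz1, hz2⟩
  have hz4 := image_closure_subset_closure_image T.continuous ⟨_, hz3, rfl⟩
  refine closure_minimal ?_ hC.isClosed hz4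
  rintro _ ⟨x, ⟨hx1, hx2⟩, rfl⟩
  exact key x hx2 (by simpa using hx1)
end

section
/- Let T be a strictly singular, injective bounded linear operator on an infinite dimensional Banach space X, let Y be an infinite dimensional closed subspace of X, F a finite codimensional closed subspace of X, f : (0,1) → (0,1) a function with f(η) decreasing to 0 as η decreases to 0, and i₀ a nonnegative integer. Then there exists η₀ > 0 such that for every η with 0 < η ≤ η₀ there exists x ∈ Y with ‖x‖ = 1 satisfying: T^{i-1} x ∈ F and ‖T^i x‖ ≤ η ‖T^{i-1} x‖ for i = 1, 2, ..., i₀ + 2; and bc{T^{i₀} x/‖T^{i₀} x‖, T^{i₀+1} x/‖T^{i₀+1} x‖} ≤ 1/f(η). -/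
open Submodule in
theorem h_small {X : Type*} [NormedAddCommGroup X] [NormedSpace ℝ X]
    (T : X →L[ℝ] X) (hT : StrictlySingular T) (V : Submodule ℝ X) (hV : ¬ V.FG)
    (c : ℝ) (hc : 0 < c) : ∃ v ∈ V, ‖v‖ = 1 ∧ ‖T v‖ ≤ c := by
  by_contra hcon
  push Not at hcon
  have h1 : ∀ v ∈ V, c * ‖v‖ ≤ ‖T v‖ := by
    intro v hv
    by_cases h0 : v = 0
    · simp [h0]
    have hp : 0 < ‖v‖ := norm_pos_iff.2 h0
    have := hcon (‖v‖⁻¹ • v) (V.smul_mem _ hv) (by rw [norm_smul, norm_inv, norm_norm]; field_simp)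
    rw [map_smul, norm_smul, norm_inv, norm_norm, inv_mul_eq_div, lt_div_iff₀ hp] at this
    exact this.le
  refine hT V.topologicalClosure V.isClosed_topologicalClosure ?_ ⟨c, hc, ?_⟩
  · intro hfd
    apply hV
    have : FiniteDimensional ℝ V := by
      exact Submodule.finiteDimensional_of_le V.le_topologicalClosure
    exact Module.Finite.iff_fg.1 this
  · intro y hy
    have hcl : IsClosed {y : X | c * ‖y‖ ≤ ‖T y‖} :=
      isClosed_le (by fun_prop) (by fun_prop)
    exact closure_minimal (s := (V : Set X)) h1 hcl hy

theorem h_inf {X G : Type*} [NormedAddCommGroup X] [NormedSpace ℝ X]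
    [AddCommGroup G] [Module ℝ G] [FiniteDimensional ℝ G]
    (P : X →ₗ[ℝ] G) (V : Submodule ℝ X) (hV : ¬ V.FG) : ¬ (V ⊓ LinearMap.ker P).FG := by
  intro h
  exact hV (Submodule.fg_of_fg_map_of_fg_inf_ker P (IsNoetherian.noetherian _) h)

theorem h_lemA {X : Type*} [NormedAddCommGroup X] [NormedSpace ℝ X]
    (T : X →L[ℝ] X) (hT : StrictlySingular T) (hinj : Function.Injective T)
    (V : Submodule ℝ X) (hV : ¬ V.FG) (ε : ℝ) (hε : 0 < ε) :
    ∃ W ≤ V, ¬ W.FG ∧ ∀ w ∈ W, ‖T w‖ ≤ ε * ‖w‖ := by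
  have hφ : ∀ x : X, ∃ g : X →L[ℝ] ℝ, ‖g‖ ≤ 1 ∧ g x = ‖x‖ := fun x => by
    obtain ⟨g, h1, h2⟩ := exists_dual_vector'' ℝ x
    exact ⟨g, h1, by simpa using h2⟩
  choose φ hφ1 hφ2 using hφ
  obtain ⟨w, hw, hr⟩ := exists_seq_of_forall_finset_exists
    (fun x : X => x ∈ V ∧ ‖x‖ = 1 ∧ ‖T x‖ ≤ ε / 2)
    (fun x y => φ x y = 0 ∧ ‖T y‖ ≤ (1/4) * ‖T x‖) (by
      intro s hs
      have hpos : ∀ x ∈ s, 0 < ‖T x‖ := by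
        intro x hx
        rw [norm_pos_iff]
        intro h0
        have : x = 0 := hinj (by simpa using h0)
        have h1 := (hs x hx).2.1
        simp [this] at h1
      obtain ⟨c, hc, hcs⟩ : ∃ c : ℝ, 0 < c ∧ ∀ x ∈ s, c ≤ (1/4) * ‖T x‖ := by
        clear hs
        induction s using Finset.cons_induction with
        | empty => exact ⟨1, one_pos, by simp⟩
        | cons a s ha ih =>
          obtain ⟨c, hc, h⟩ := ih (fun x hx => hpos x (Finset.mem_cons_of_mem hx))
          have := hpos a (Finset.mem_cons_self a s)
          refine ⟨min c ((1/4) * ‖T a‖), by positivity, ?_⟩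
          intro x hx
          rcases Finset.mem_cons.1 hx with rfl | hx
          · exact min_le_right _ _
          · exact (min_le_left _ _).trans (h x hx)
      let P : X →ₗ[ℝ] (s → ℝ) := LinearMap.pi fun x => (φ x : X →ₗ[ℝ] ℝ)
      obtain ⟨v, hv, hv1, hvT⟩ := h_small T hT _ (h_inf P V hV) (min c (ε/2)) (by positivity)
      refine ⟨v, ⟨hv.1, hv1, hvT.trans (min_le_right _ _)⟩, fun x hx => ⟨?_, ?_⟩⟩
      · have := congrFun (LinearMap.mem_ker.1 hv.2) ⟨x, hx⟩
        simpa [P] using this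
      · exact (hvT.trans (min_le_left _ _)).trans (hcs x hx))
  have hTw : ∀ n, ‖T (w n)‖ ≤ (ε / 2) * (1/4)^n := by
    intro n
    induction n with
    | zero => simpa using (hw 0).2.2
    | succ n ih =>
      have := (hr n (n+1) (Nat.lt_succ_self n)).2
      rw [pow_succ]; linarith
  let L : (ℕ →₀ ℝ) →ₗ[ℝ] X := Finsupp.linearCombination ℝ w
  have hL : ∀ a : ℕ →₀ ℝ, ∃ N, ∀ n, N ≤ n → L a = ∑ k ∈ Finset.range n, a k • w k := by
    intro a
    refine ⟨a.support.sup id + 1, fun n hn => ?_⟩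
    simp only [L, Finsupp.linearCombination_apply]
    apply Finsupp.sum_of_support_subset
    · intro k hk
      have : k ≤ a.support.sup id := Finset.le_sup (f := id) hk
      simp; omega
    · simp
  have hcoef : ∀ (a : ℕ →₀ ℝ) (n : ℕ), |a n| ≤ 2 ^ n * ‖L a‖ := by
    intro a
    obtain ⟨N, hN⟩ := hL a
    intro n
    induction n using Nat.strong_induction_on with
    | _ n ih =>
      have h1 := hN (N + (n + 1)) (by omega)
      have h2 : φ (w n) (L a) = ∑ k ∈ Finset.range (n+1), a k * φ (w n) (w k) := by
        rw [h1, map_sum]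
        simp only [map_smul, smul_eq_mul]
        symm
        apply Finset.sum_subset
        · intro k; simp; omega
        · intro k _ hk
          rw [(hr n k (by simp at hk; omega)).1, mul_zero]
      rw [Finset.sum_range_succ, hφ2, (hw n).2.1, mul_one] at h2
      have h3 : |φ (w n) (L a)| ≤ ‖L a‖ := by
        have := (φ (w n)).le_of_opNorm_le (hφ1 (w n)) (L a)
        simpa using this
      have h4 : |∑ k ∈ Finset.range n, a k * φ (w n) (w k)|
          ≤ ∑ k ∈ Finset.range n, 2 ^ k * ‖L a‖ := by
        refine (Finset.abs_sum_le_sum_abs _ _).trans (Finset.sum_le_sum fun k hk => ?_)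
        rw [abs_mul]
        have h5 : |φ (w n) (w k)| ≤ 1 := by
          have := (φ (w n)).le_of_opNorm_le (hφ1 (w n)) (w k)
          simpa [(hw k).2.1] using this
        have := ih k (Finset.mem_range.1 hk)
        calc |a k| * |φ (w n) (w k)| ≤ |a k| * 1 := by gcongr
          _ ≤ _ := by linarith
      rw [← Finset.sum_mul, geom_sum_eq (by norm_num)] at h4
      have h6 : a n = φ (w n) (L a) - ∑ k ∈ Finset.range n, a k * φ (w n) (w k) := by
        rw [h2]; ring
      rw [h6]
      refine (abs_sub _ _).trans ?_
      have : ((2:ℝ) ^ n - 1) / (2 - 1) * ‖L a‖ = 2 ^ n * ‖L a‖ - ‖L a‖ := by ring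
      linarith
  have hLinj : Function.Injective L := by
    rw [injective_iff_map_eq_zero]
    intro a ha
    ext n
    have := hcoef a n
    rw [ha] at this
    simpa using this
  refine ⟨LinearMap.range L, ?_, ?_, ?_⟩
  · rintro _ ⟨a, rfl⟩
    obtain ⟨N, hN⟩ := hL a
    rw [hN N le_rfl]
    exact V.sum_mem fun k _ => V.smul_mem _ (hw k).1
  · intro hfg
    have hfin : Module.Finite ℝ (LinearMap.range L) := Module.Finite.iff_fg.2 hfg
    have : Module.Finite ℝ (ℕ →₀ ℝ) :=
      Module.Finite.equiv (LinearEquiv.ofInjective L hLinj).symm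
    have hli := (Finsupp.basisSingleOne (R := ℝ) (ι := ℕ)).linearIndependent
    have := hli.finite
    exact not_finite ℕ
  · rintro _ ⟨a, rfl⟩
    obtain ⟨N, hN⟩ := hL a
    have h1 : ‖T (L a)‖ ≤ ∑ k ∈ Finset.range N, (ε/2 * ‖L a‖) * (1/2)^k := by
      conv_lhs => rw [hN N le_rfl, map_sum]
      refine (norm_sum_le _ _).trans (Finset.sum_le_sum fun k _ => ?_)
      rw [map_smul, norm_smul, Real.norm_eq_abs]
      calc |a k| * ‖T (w k)‖ ≤ (2 ^ k * ‖L a‖) * ((ε / 2) * (1/4)^k) := by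
            gcongr
            · exact hcoef a k
            · exact hTw k
        _ = (ε/2 * ‖L a‖) * (2 * (1/4)) ^ k := by rw [mul_pow]; ring
        _ = _ := by norm_num
    rw [← Finset.mul_sum] at h1
    have h2 : ∑ k ∈ Finset.range N, ((1:ℝ)/2)^k ≤ 2 := sum_geometric_two_le N
    calc ‖T (L a)‖ ≤ _ := h1
      _ ≤ (ε/2 * ‖L a‖) * 2 := by gcongr
      _ = _ := by ring

theorem h_powinj {X : Type*} [NormedAddCommGroup X] [NormedSpace ℝ X]
    (T : X →L[ℝ] X) (hinj : Function.Injective T) (n : ℕ) : Function.Injective (T ^ n) := by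
  induction n with
  | zero => intro a b h; simpa using h
  | succ n ih =>
    intro a b h
    rw [pow_succ'] at h
    exact ih (hinj h)

theorem h_mapFG {X : Type*} [NormedAddCommGroup X] [NormedSpace ℝ X]
    (S : X →ₗ[ℝ] X) (hinj : Function.Injective S) (W : Submodule ℝ X) (hW : ¬ W.FG) :
    ¬ (W.map S).FG := fun h =>
  hW (Submodule.fg_of_fg_map_injective S hinj h)

theorem h_sub {X : Type*} [NormedAddCommGroup X] [NormedSpace ℝ X]
    (T : X →L[ℝ] X) (hT : StrictlySingular T) (hinj : Function.Injective T)
    (V : Submodule ℝ X) (hV : ¬ V.FG) (F : Submodule ℝ X) (hF : FiniteDimensional ℝ (X ⧸ F))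
    (ε : ℝ) (hε : 0 < ε) (n : ℕ) :
    ∃ W ≤ V, ¬ W.FG ∧ ∀ w ∈ W, ∀ i < n, (T ^ i) w ∈ F ∧ ‖(T ^ (i+1)) w‖ ≤ ε * ‖(T ^ i) w‖ := by
  induction n with
  | zero => exact ⟨V, le_rfl, hV, by simp⟩
  | succ n ih =>
    obtain ⟨W, hWV, hW, h⟩ := ih
    let S : X →ₗ[ℝ] X := ((T ^ n : X →L[ℝ] X) : X →ₗ[ℝ] X)
    have hS : ∀ x, S x = (T ^ n) x := fun _ => rfl
    have h1 : ¬ (W.map S).FG := h_mapFG S (h_powinj T hinj n) W hW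
    have h2 := h_inf F.mkQ _ h1
    rw [Submodule.ker_mkQ] at h2
    obtain ⟨W', hW'le, hW', hW'T⟩ := h_lemA T hT hinj _ h2 ε hε
    refine ⟨W ⊓ W'.comap S, inf_le_left.trans hWV, ?_, ?_⟩
    · intro hfg
      apply hW'
      have : W' = (W ⊓ W'.comap S).map S := by
        apply le_antisymm
        · intro y hy
          obtain ⟨x, hx, rfl⟩ := (hW'le hy).1
          exact ⟨x, ⟨hx, hy⟩, rfl⟩
        · rintro _ ⟨x, hx, rfl⟩
          exact hx.2
      rw [this]
      exact hfg.map S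
    · intro w hw i hi
      rcases Nat.lt_succ_iff_lt_or_eq.1 hi with hi | rfl
      · exact h w hw.1 i hi
      · refine ⟨(hW'le hw.2).2, ?_⟩
        have := hW'T _ hw.2
        rw [hS] at this
        rw [pow_succ']
        exact this

theorem h_sep {X : Type*} [NormedAddCommGroup X] [NormedSpace ℝ X]
    (T : X →L[ℝ] X) (hT : StrictlySingular T) (hinj : Function.Injective T)
    (U : Submodule ℝ X) (hU : ¬ U.FG) :
    ∃ u ∈ U, u ≠ 0 ∧ ∀ s : ℝ, (1/100) * ‖T u‖ ≤ ‖T u - s • u‖ := by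
  by_contra hcon
  push Not at hcon
  obtain ⟨u, hu, hu1, -⟩ := h_small T hT U hU 1 one_pos
  have hu0 : u ≠ 0 := by rintro rfl; simp at hu1
  have hr : 0 < ‖T u‖ := by
    rw [norm_pos_iff]; intro h0; exact hu0 (hinj (by simpa using h0))
  obtain ⟨φ, hφ1, hφ2⟩ := exists_dual_vector'' ℝ u
  have hφ2 : φ u = 1 := by simpa [hu1] using hφ2
  obtain ⟨v, hv, hv1, hvT⟩ := h_small T hT _ (h_inf (φ : X →ₗ[ℝ] ℝ) U hU) ((1/100) * ‖T u‖)
    (by positivity)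
  have hφv : φ v = 0 := hv.2
  have huv0 : u + v ≠ 0 := by
    intro h0
    have : φ (u + v) = 0 := by rw [h0, map_zero]
    rw [map_add, hφ2, hφv] at this; norm_num at this
  obtain ⟨l, hl⟩ := hcon u hu hu0
  obtain ⟨m, hm⟩ := hcon (u + v) (U.add_mem hu hv.1) huv0
  set r := ‖T u‖ with hrdef
  have hTuv : ‖T (u + v)‖ ≤ r + (1/100) * r := by
    rw [map_add]; exact (norm_add_le _ _).trans (by linarith)
  have key : ‖(l - m) • u - m • v‖ ≤ (4/100) * r := by
    have : (l - m) • u - m • v = (T (u+v) - m • (u + v)) - (T u - l • u) - T v := by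
      rw [map_add]; module
    rw [this]
    have h1 := norm_sub_le (T (u+v) - m • (u + v) - (T u - l • u)) (T v)
    have h2 := norm_sub_le (T (u+v) - m • (u + v)) (T u - l • u)
    linarith
  have k1 : |l - m| ≤ (4/100) * r := by
    have := φ.le_of_opNorm_le hφ1 ((l - m) • u - m • v)
    rw [map_sub, map_smul, map_smul, hφ2, hφv] at this
    simp only [smul_eq_mul, mul_one, mul_zero, sub_zero, one_mul, Real.norm_eq_abs] at this
    linarith
  have k2 : |m| ≤ (8/100) * r := by
    have e1 : ‖m • v‖ = |m| := by rw [norm_smul, hv1, mul_one, Real.norm_eq_abs]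
    have e2 : ‖(l - m) • u‖ = |l - m| := by rw [norm_smul, hu1, mul_one, Real.norm_eq_abs]
    have := norm_sub_norm_le (m • v) ((l - m) • u)
    rw [norm_sub_rev] at this
    linarith
  have k3 : r ≤ |l| + (1/100) * r := by
    have e2 : ‖l • u‖ = |l| := by rw [norm_smul, hu1, mul_one, Real.norm_eq_abs]
    have := norm_sub_norm_le (T u) (l • u)
    linarith
  have k4 : |l| ≤ |l - m| + |m| := by
    have := abs_add_le (l - m) m
    simpa using this
  linarith

theorem h_bc {X : Type*} [NormedAddCommGroup X] [NormedSpace ℝ X]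
    (u v : X) (hu : u ≠ 0) (hv : v ≠ 0) (h : ∀ s : ℝ, (1/100) * ‖v‖ ≤ ‖v - s • u‖)
    (A B : ℝ) (hAB : ‖A • (‖u‖⁻¹ • u) + B • (‖v‖⁻¹ • v)‖ = 1) : |A| ≤ 200 ∧ |B| ≤ 200 := by
  have hu' : 0 < ‖u‖ := norm_pos_iff.2 hu
  have hv' : 0 < ‖v‖ := norm_pos_iff.2 hv
  have hB : |B| ≤ 100 := by
    by_cases hB0 : B = 0
    · simp [hB0]
    have e : A • (‖u‖⁻¹ • u) + B • (‖v‖⁻¹ • v)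
        = (B * ‖v‖⁻¹) • (v - (-(A * ‖u‖⁻¹ * ‖v‖ / B)) • u) := by
      rw [smul_sub, smul_smul, smul_smul, smul_smul, ← sub_eq_zero]
      have : B * ‖v‖⁻¹ * -(A * ‖u‖⁻¹ * ‖v‖ / B) = -(A * ‖u‖⁻¹) := by field_simp
      rw [this]; module
    rw [e, norm_smul, norm_mul, norm_inv, norm_norm, Real.norm_eq_abs] at hAB
    have h1 := h (-(A * ‖u‖⁻¹ * ‖v‖ / B))
    have h2 : |B| * ‖v‖⁻¹ * ((1/100) * ‖v‖) ≤ 1 := by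
      calc _ ≤ _ := mul_le_mul_of_nonneg_left h1 (by positivity)
        _ = 1 := hAB
    have h3 : |B| * ‖v‖⁻¹ * ((1/100) * ‖v‖) = |B| / 100 := by field_simp
    linarith
  have n1 : ‖A • (‖u‖⁻¹ • u)‖ = |A| := by
    rw [norm_smul, norm_smul, norm_inv, norm_norm, inv_mul_cancel₀ hu'.ne', mul_one,
      Real.norm_eq_abs]
  have n2 : ‖B • (‖v‖⁻¹ • v)‖ = |B| := by
    rw [norm_smul, norm_smul, norm_inv, norm_norm, inv_mul_cancel₀ hv'.ne', mul_one,
      Real.norm_eq_abs]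
  have := norm_sub_le (A • (‖u‖⁻¹ • u) + B • (‖v‖⁻¹ • v)) (B • (‖v‖⁻¹ • v))
  rw [add_sub_cancel_right] at this
  constructor <;> linarith


theorem stmt_15 {X : Type*} [NormedAddCommGroup X] [NormedSpace ℝ X] [CompleteSpace X]
    (hX : ¬ FiniteDimensional ℝ X) (T : X →L[ℝ] X)
    (hT : StrictlySingular T) (hinj : Function.Injective T)
    (Y : Submodule ℝ X) (hYc : IsClosed (Y : Set X)) (hY : ¬ FiniteDimensional ℝ Y)
    (F : Submodule ℝ X) (hFc : IsClosed (F : Set X)) (hF : FiniteDimensional ℝ (X ⧸ F))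
    (f : ℝ → ℝ) (hfmem : ∀ η ∈ Set.Ioo (0 : ℝ) 1, f η ∈ Set.Ioo (0 : ℝ) 1)
    (hfmono : MonotoneOn f (Set.Ioo (0 : ℝ) 1))
    (hf0 : Filter.Tendsto f (nhdsWithin 0 (Set.Ioi 0)) (nhds 0))
    (i₀ : ℕ) :
    ∃ η₀ ∈ Set.Ioo (0 : ℝ) 1, ∀ η : ℝ, 0 < η → η ≤ η₀ →
      ∃ x ∈ Y, ‖x‖ = 1 ∧
        (∀ i, 1 ≤ i → i ≤ i₀ + 2 →
          (T ^ (i - 1)) x ∈ F ∧ ‖(T ^ i) x‖ ≤ η * ‖(T ^ (i - 1)) x‖) ∧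
        (∀ A₀ A₁ : ℝ,
          ‖A₀ • (‖(T ^ i₀) x‖⁻¹ • (T ^ i₀) x) +
              A₁ • (‖(T ^ (i₀ + 1)) x‖⁻¹ • (T ^ (i₀ + 1)) x)‖ = 1 →
          |A₀| ≤ 1 / f η ∧ |A₁| ≤ 1 / f η) := by
  have hYfg : ¬ Y.FG := fun h => hY (Module.Finite.iff_fg.2 h)
  have hev : ∀ᶠ η in nhdsWithin (0:ℝ) (Set.Ioi 0), f η < 1/200 :=
    hf0.eventually (gt_mem_nhds (by norm_num))
  obtain ⟨d, hd, hd'⟩ := mem_nhdsGT_iff_exists_Ioo_subset.1 hev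
  have hd : 0 < d := hd
  refine ⟨min (d/2) (1/2), ⟨by positivity, (min_le_right _ _).trans_lt (by norm_num)⟩, ?_⟩
  intro η hη hη'
  have hηd : η < d := by have := hη'.trans (min_le_left _ _); linarith
  have hη1 : η < 1 := by have := hη'.trans (min_le_right _ _); linarith
  have hfη : f η < 1/200 := hd' ⟨hη, hηd⟩
  have hfpos : 0 < f η := (hfmem η ⟨hη, hη1⟩).1
  have h200 : 200 ≤ 1 / f η := by rw [le_div_iff₀ hfpos]; linarith
  obtain ⟨W, hWY, hW, h⟩ := h_sub T hT hinj Y hYfg F hF η hη (i₀ + 2)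
  let S : X →ₗ[ℝ] X := ((T ^ i₀ : X →L[ℝ] X) : X →ₗ[ℝ] X)
  obtain ⟨_, ⟨w, hw, rfl⟩, hu0, hs⟩ := h_sep T hT hinj _ (h_mapFG S (h_powinj T hinj i₀) W hW)
  have hS : S w = (T ^ i₀) w := rfl
  rw [hS] at hu0 hs
  have hw0 : w ≠ 0 := by rintro rfl; simp at hu0
  have hwp : 0 < ‖w‖ := norm_pos_iff.2 hw0
  have hxW : ‖w‖⁻¹ • w ∈ W := W.smul_mem _ hw
  refine ⟨‖w‖⁻¹ • w, hWY hxW, ?_, ?_, ?_⟩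
  · rw [norm_smul, norm_inv, norm_norm, inv_mul_cancel₀ hwp.ne']
  · intro i hi hi2
    obtain ⟨j, rfl⟩ : ∃ j, i = j + 1 := ⟨i - 1, by omega⟩
    exact h _ hxW j (by omega)
  · intro A B hAB
    have hsucc : ∀ y, (T ^ (i₀ + 1)) y = T ((T ^ i₀) y) := fun y => by rw [pow_succ']; rfl
    rw [hsucc] at hAB
    have hu : (T ^ i₀) (‖w‖⁻¹ • w) ≠ 0 := by
      rw [map_smul]; exact smul_ne_zero (inv_ne_zero hwp.ne') hu0
    have hv : T ((T ^ i₀) (‖w‖⁻¹ • w)) ≠ 0 := fun h0 => hu (hinj (by simpa using h0))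
    have := h_bc _ _ hu hv (by
      intro s
      rw [map_smul, map_smul, smul_comm s, ← smul_sub, norm_smul, norm_smul]
      have := mul_le_mul_of_nonneg_left (hs s) (norm_nonneg (‖w‖⁻¹))
      linarith) A B hAB
    exact ⟨this.1.trans h200, this.2.trans h200⟩
end

section
/- Let T be a strictly singular, injective bounded linear operator on an infinite dimensional Banach space X, and let Y be an infinite dimensional closed subspace of X. Then for every natural number n there exists a norm-one vector z ∈ Y such that ‖T^i z‖ ≤ (1/(n² · 2^{2n+4})) ‖T^{i-1} z‖ for i = 1, ..., n+1, and bc{z, Tz/‖Tz‖, ..., T^n z/‖T^n z‖} ≤ n · 2^{n+2}. -/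
lemma norming {X : Type*} [NormedAddCommGroup X] [NormedSpace ℝ X] (F : Submodule ℝ X)
    [FiniteDimensional ℝ F] : ∃ t : Finset (X →L[ℝ] ℝ), ∀ w : X, (∀ φ ∈ t, φ w = 0) →
      ∀ f ∈ F, ‖f‖ ≤ 3 / 2 * ‖f + w‖ := by
  classical
  have hc : IsCompact (Metric.sphere (0 : F) 1) := isCompact_sphere _ _
  have hφ : ∀ x : F, ∃ g : X →L[ℝ] ℝ, ‖g‖ ≤ 1 ∧ g (x : X) = ‖(x : X)‖ := by
    intro x
    obtain ⟨g, h1, h2⟩ := exists_dual_vector'' ℝ (x : X)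
    exact ⟨g, h1, by simpa using h2⟩
  choose g hg1 hg2 using hφ
  obtain ⟨t, ht, hcov⟩ := hc.elim_nhds_subcover (fun x => {y : F | 2 / 3 < g x (y : X)}) (by
    intro x hx
    have hx1 : ‖(x : X)‖ = 1 := by simpa using hx
    apply IsOpen.mem_nhds
    · exact isOpen_lt continuous_const (by fun_prop)
    · simp only [Set.mem_ofPred_eq, hg2, hx1]; norm_num)
  refine ⟨t.image g, ?_⟩
  intro w hw f hf
  by_cases h0 : f = 0
  · subst h0; simp
  have hpos : 0 < ‖f‖ := norm_pos_iff.mpr h0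
  have hmem : (⟨‖f‖⁻¹ • f, F.smul_mem _ hf⟩ : F) ∈ Metric.sphere (0 : F) 1 := by
    simp [norm_smul, hpos.ne']
  have := hcov hmem
  simp only [Set.mem_iUnion, Set.mem_ofPred_eq, map_smul, smul_eq_mul] at this
  obtain ⟨x, hx, hlt⟩ := this
  have hw0 : g x w = 0 := hw _ (Finset.mem_image_of_mem _ hx)
  have h1 : g x (f + w) ≤ ‖f + w‖ := by
    calc g x (f + w) ≤ ‖g x (f + w)‖ := Real.le_norm_self _
      _ ≤ ‖g x‖ * ‖f + w‖ := (g x).le_opNorm _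
      _ ≤ 1 * ‖f + w‖ := by gcongr; exact hg1 x
      _ = _ := one_mul _
  rw [map_add, hw0, add_zero] at h1
  have h2 : 2 / 3 * ‖f‖ < g x f := by
    rw [inv_mul_eq_div, lt_div_iff₀ hpos] at hlt
    exact hlt
  linarith

lemma infdim_ker {X : Type*} [NormedAddCommGroup X] [NormedSpace ℝ X] (V : Submodule ℝ X)
    (hV : ¬ FiniteDimensional ℝ V) (t : Finset (X →L[ℝ] ℝ)) :
    ∃ W : Submodule ℝ X, W ≤ V ∧ ¬ FiniteDimensional ℝ W ∧ ∀ w ∈ W, ∀ φ ∈ t, φ w = 0 := by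
  let Φ : X →ₗ[ℝ] (t → ℝ) := LinearMap.pi (fun φ => (φ.1 : X →ₗ[ℝ] ℝ))
  refine ⟨V ⊓ LinearMap.ker Φ, inf_le_left, ?_, ?_⟩
  · intro h
    apply hV
    let Ψ : V →ₗ[ℝ] (t → ℝ) := Φ.comp V.subtype
    have e : FiniteDimensional ℝ (LinearMap.ker Ψ) := by
      let j : LinearMap.ker Ψ →ₗ[ℝ] (V ⊓ LinearMap.ker Φ : Submodule ℝ X) :=
        LinearMap.codRestrict _ (V.subtype.comp (LinearMap.ker Ψ).subtype) (by
          rintro ⟨⟨x, hx⟩, hx2⟩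
          exact ⟨hx, hx2⟩)
      apply FiniteDimensional.of_injective j
      intro a b hab
      have := congrArg Subtype.val hab
      exact Subtype.ext (Subtype.ext this)
    have e2 : FiniteDimensional ℝ (V ⧸ LinearMap.ker Ψ) :=
      Module.Finite.equiv (Ψ.quotKerEquivRange).symm
    exact Module.Finite.of_submodule_quotient (LinearMap.ker Ψ)
  · rintro w ⟨-, hw⟩ φ hφ
    exact congrFun (LinearMap.mem_ker.mp hw) ⟨φ, hφ⟩

lemma small_vec {X : Type*} [NormedAddCommGroup X] [NormedSpace ℝ X] (T : X →L[ℝ] X)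
    (hT : StrictlySingular T) (V : Submodule ℝ X) (hV : ¬ FiniteDimensional ℝ V)
    (δ : ℝ) (hδ : 0 < δ) : ∃ z ∈ V, ‖z‖ = 1 ∧ ‖T z‖ ≤ δ := by
  by_contra hcon
  push Not at hcon
  apply hT V.topologicalClosure V.isClosed_topologicalClosure
  · intro h
    exact hV (Submodule.finiteDimensional_of_le V.le_topologicalClosure)
  · refine ⟨δ, hδ, ?_⟩
    have hcl : IsClosed {y : X | δ * ‖y‖ ≤ ‖T y‖} := isClosed_le (by fun_prop) (by fun_prop)
    have hsub : (V : Set X) ⊆ {y : X | δ * ‖y‖ ≤ ‖T y‖} := by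
      intro y hy
      by_cases h0 : y = 0
      · simp [h0]
      have hpos : 0 < ‖y‖ := norm_pos_iff.mpr h0
      have := hcon (‖y‖⁻¹ • y) (V.smul_mem _ hy) (by simp [norm_smul, hpos.ne'])
      rw [map_smul, norm_smul, norm_inv, norm_norm, inv_mul_eq_div, lt_div_iff₀ hpos] at this
      exact this.le
    intro y hy
    exact closure_minimal hsub hcl hy

lemma main_ind {X : Type*} [NormedAddCommGroup X] [NormedSpace ℝ X] (T : X →L[ℝ] X)
    (hT : StrictlySingular T) (hinj : Function.Injective T) (n : ℕ) :
    ∀ (V : Submodule ℝ X), ¬ FiniteDimensional ℝ V → ∀ ε : ℝ, 0 < ε →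
    ∃ z ∈ V, z ≠ 0 ∧ (∀ i ≤ n, ‖(T ^ (i + 1)) z‖ ≤ ε * ‖(T ^ i) z‖) ∧
      ∀ α : ℕ → ℝ, ∀ j ≤ n, |α j| * ‖(T ^ j) z‖ ≤
        2 ^ (n + 2) * ‖∑ i ∈ Finset.range (n + 1), α i • (T ^ i) z‖ := by
  classical
  have hpw : ∀ (i : ℕ) (x : X), (T ^ (i + 1)) x = (T ^ i) (T x) := fun i x => by
    rw [pow_succ]; rfl
  have hne : ∀ (i : ℕ) (x : X), x ≠ 0 → (T ^ i) x ≠ 0 := by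
    intro i
    induction i with
    | zero => intro x hx; simpa using hx
    | succ i ih =>
      intro x hx
      rw [hpw]
      exact ih _ (fun h => hx (hinj (by simpa using h)))
  induction n with
  | zero =>
    intro V hV ε hε
    obtain ⟨z, hz, hz1, hz2⟩ := small_vec T hT V hV ε hε
    refine ⟨z, hz, by rintro rfl; simp at hz1, ?_, ?_⟩
    · intro i hi
      obtain rfl : i = 0 := by omega
      simpa [hz1] using hz2
    · intro α j hj
      obtain rfl : j = 0 := by omega
      simp [norm_smul, hz1]
      nlinarith [abs_nonneg (α 0)]
  | succ n ih =>
    intro V hV ε hε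
    have hV' : ¬ FiniteDimensional ℝ (V.map (T : X →ₗ[ℝ] X)) := by
      intro h
      exact hV (Module.Finite.equiv (Submodule.equivMapOfInjective (T : X →ₗ[ℝ] X) hinj V).symm)
    obtain ⟨u, hu, hu0, hur, hub⟩ := ih _ hV' (ε / 2) (by positivity)
    obtain ⟨z1, hz1, rfl⟩ := hu
    simp only [ContinuousLinearMap.coe_coe] at hu0 hur hub
    have hz10 : z1 ≠ 0 := by rintro rfl; simp at hu0
    set C : ℝ := 2 ^ (n + 2) with hC
    have hC4 : 4 ≤ C := by
      rw [hC, pow_add]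
      have : (1 : ℝ) ≤ 2 ^ n := one_le_pow₀ (by norm_num)
      linarith
    obtain ⟨η, hη0, hη⟩ : ∃ η : ℝ, 0 < η ∧ η * (5 / 2 + (n + 1) * (3 / 2 * C)) = 1 / 16 := by
      have : 0 < (5 / 2 + (n + 1) * (3 / 2 * C)) := by positivity
      exact ⟨1 / 16 / (5 / 2 + (n + 1) * (3 / 2 * C)), by positivity, by field_simp⟩
    have hη1 : η ≤ 1 / 16 := by
      have : 1 ≤ (5 / 2 + ((n : ℝ) + 1) * (3 / 2 * C)) := by
        have : 0 ≤ ((n : ℝ) + 1) * (3 / 2 * C) := by positivity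
        linarith
      nlinarith
    have hn1 : 0 < ‖z1‖ := norm_pos_iff.mpr hz10
    have hn2 : 0 < ‖T z1‖ := norm_pos_iff.mpr hu0
    obtain ⟨c, hc0, hc1, hc2⟩ : ∃ c : ℝ, 0 < c ∧ c * ‖z1‖ ≤ η ∧ 4 * (c * ‖T z1‖) ≤ ε := by
      refine ⟨min (η / ‖z1‖) (ε / (4 * ‖T z1‖)), by positivity, ?_, ?_⟩
      · rw [← le_div_iff₀ hn1]; exact min_le_left _ _
      · have := min_le_right (η / ‖z1‖) (ε / (4 * ‖T z1‖))
        rw [le_div_iff₀ (by positivity)] at this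
        linarith
    obtain ⟨δ, hδ0, hδ⟩ : ∃ δ : ℝ, 0 < δ ∧ ∀ i ∈ Finset.range (n + 2),
        ‖T ^ i‖ * δ ≤ η * (c * ‖(T ^ (i + 1)) z1‖) := by
      have : ∀ᶠ δ : ℝ in nhdsWithin 0 (Set.Ioi 0), ∀ i ∈ Finset.range (n + 2),
          ‖T ^ i‖ * δ ≤ η * (c * ‖(T ^ (i + 1)) z1‖) := by
        rw [Filter.eventually_all_finset]
        intro i _
        apply Filter.Eventually.filter_mono nhdsWithin_le_nhds
        have hp : 0 < ‖(T ^ (i + 1)) z1‖ := norm_pos_iff.mpr (hne _ _ hz10)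
        have hct : Filter.Tendsto (fun δ : ℝ => ‖T ^ i‖ * δ) (nhds 0) (nhds (‖T ^ i‖ * 0)) :=
          (continuous_const.mul continuous_id).tendsto 0
        rw [mul_zero] at hct
        exact hct.eventually_le_const (by positivity)
      obtain ⟨δ, h1, h2⟩ := (this.and self_mem_nhdsWithin).exists
      exact ⟨δ, h2, h1⟩
    let F : Submodule ℝ X := Submodule.span ℝ
      ((Finset.range (n + 1)).image (fun i => (T ^ (i + 1)) z1) : Finset X)
    have : FiniteDimensional ℝ F := FiniteDimensional.span_finset ℝ _
    obtain ⟨t, ht⟩ := norming F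
    obtain ⟨W, hWV, hW, hWt⟩ := infdim_ker V hV t
    obtain ⟨z0, hz0, hz01, hz0T⟩ := small_vec T hT W hW δ hδ0
    have hsm : ∀ i ≤ n + 1, ‖(T ^ (i + 1)) z0‖ ≤ η * (c * ‖(T ^ (i + 1)) z1‖) := by
      intro i hi
      refine le_trans ?_ (hδ i (Finset.mem_range.mpr (by omega)))
      rw [hpw]
      exact ((T ^ i).le_opNorm _).trans (by gcongr)
    have hzexp : ∀ i, (T ^ i) (z0 + c • z1) = (T ^ i) z0 + c • (T ^ i) z1 := by
      intro i; rw [map_add, map_smul]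
    have hnc : ∀ i, ‖c • (T ^ i) z1‖ = c * ‖(T ^ i) z1‖ := by
      intro i; rw [norm_smul, Real.norm_of_nonneg hc0.le]
    have hup : ∀ i ≤ n + 1, ‖(T ^ (i + 1)) (z0 + c • z1)‖ ≤ (1 + η) * (c * ‖(T ^ (i + 1)) z1‖) := by
      intro i hi
      rw [hzexp]
      have := norm_add_le ((T ^ (i + 1)) z0) (c • (T ^ (i + 1)) z1)
      rw [hnc] at this
      linarith [hsm i hi]
    have hlo : ∀ i ≤ n + 1, (1 - η) * (c * ‖(T ^ (i + 1)) z1‖) ≤ ‖(T ^ (i + 1)) (z0 + c • z1)‖ := by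
      intro i hi
      rw [hzexp]
      have := norm_sub_le ((T ^ (i + 1)) z0 + c • (T ^ (i + 1)) z1) ((T ^ (i + 1)) z0)
      rw [add_sub_cancel_left, hnc] at this
      linarith [hsm i hi]
    have hc1' : ‖c • z1‖ ≤ η := by rw [norm_smul, Real.norm_of_nonneg hc0.le]; exact hc1
    have hzlo : 1 - η ≤ ‖z0 + c • z1‖ := by
      have := norm_sub_le (z0 + c • z1) (c • z1)
      rw [add_sub_cancel_right, hz01] at this
      linarith
    have hzup : ‖z0 + c • z1‖ ≤ 1 + η := by
      have := norm_add_le z0 (c • z1)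
      linarith
    refine ⟨z0 + c • z1, V.add_mem (hWV hz0) (V.smul_mem _ hz1), ?_, ?_, ?_⟩
    · intro h; rw [h, norm_zero] at hzlo; linarith
    · intro i hi
      rcases i with _ | i
      · have h1 := hup 0 (by omega)
        simp only [zero_add, pow_one, pow_zero, one_apply_eq_self] at h1 ⊢
        have h3 : 0 ≤ c * ‖T z1‖ := by positivity
        nlinarith
      · have h1 := hup (i + 1) (by omega)
        have h2 := hlo i (by omega)
        have h3 := hur i (by omega)
        rw [← hpw, ← hpw] at h3
        have h4 : c * ‖(T ^ (i + 1 + 1)) z1‖ ≤ ε / 2 * (c * ‖(T ^ (i + 1)) z1‖) := by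
          have := mul_le_mul_of_nonneg_left h3 hc0.le
          linarith
        have h5 : 0 ≤ c * ‖(T ^ (i + 1)) z1‖ := by positivity
        generalize c * ‖(T ^ (i + 1 + 1)) z1‖ = A at *
        generalize c * ‖(T ^ (i + 1)) z1‖ = B at *
        have h6 : (1 + η) * A ≤ (1 + η) * (ε / 2 * B) := by gcongr
        have h7 : ε * ((1 - η) * B) ≤ ε * ‖(T ^ (i + 1)) (z0 + c • z1)‖ := by gcongr
        have h8 : (1 + η) * (ε / 2 * B) ≤ ε * ((1 - η) * B) := by
          have : 0 ≤ ε * B := by positivity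
          nlinarith
        linarith
    · intro α
      set f : X := c • ∑ i ∈ Finset.range (n + 1), α (i + 1) • (T ^ (i + 1)) z1 with hf
      have hfF : f ∈ F := by
        apply F.smul_mem
        apply F.sum_mem
        intro i hi
        apply F.smul_mem
        apply Submodule.subset_span
        rw [Finset.mem_coe]
        exact Finset.mem_image_of_mem _ hi
      have hB := ht (α 0 • z0) (fun φ hφ => by rw [map_smul, hWt z0 hz0 φ hφ, smul_zero]) f hfF
      set B := ‖f + α 0 • z0‖ with hBdef
      have hB0 : 0 ≤ B := norm_nonneg _
      have ha0 : |α 0| ≤ 5 / 2 * B := by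
        have := norm_sub_le (f + α 0 • z0) f
        rw [add_sub_cancel_left, norm_smul, hz01, mul_one, Real.norm_eq_abs] at this
        linarith
      have haj : ∀ j ≤ n, |α (j + 1)| * (c * ‖(T ^ (j + 1)) z1‖) ≤ 3 / 2 * C * B := by
        intro j hj
        have h1 := hub (fun i => α (i + 1)) j hj
        simp only [← hpw] at h1
        have h2 : ‖f‖ = c * ‖∑ i ∈ Finset.range (n + 1), α (i + 1) • (T ^ (i + 1)) z1‖ := by
          rw [hf, norm_smul, Real.norm_of_nonneg hc0.le]
        have h3 := mul_le_mul_of_nonneg_left h1 hc0.le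
        have h4 : C * ‖f‖ ≤ C * (3 / 2 * B) := by gcongr
        rw [h2] at h4
        linarith
      have hS : ∑ i ∈ Finset.range (n + 1 + 1), α i • (T ^ i) (z0 + c • z1) =
          (f + α 0 • z0) + (α 0 • (c • z1) +
            ∑ i ∈ Finset.range (n + 1), α (i + 1) • (T ^ (i + 1)) z0) := by
        rw [Finset.sum_range_succ', hf, Finset.smul_sum]
        simp only [hzexp, smul_add, Finset.sum_add_distrib, pow_zero,
          one_apply_eq_self, smul_comm c]
        abel
      have hE : ‖α 0 • (c • z1) +
            ∑ i ∈ Finset.range (n + 1), α (i + 1) • (T ^ (i + 1)) z0‖ ≤ 1 / 16 * B := by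
        have e1 : ‖α 0 • (c • z1)‖ ≤ 5 / 2 * B * η := by
          rw [norm_smul, Real.norm_eq_abs]; gcongr
        have e2 : ‖∑ i ∈ Finset.range (n + 1), α (i + 1) • (T ^ (i + 1)) z0‖ ≤
            ∑ i ∈ Finset.range (n + 1), η * (3 / 2 * C * B) := by
          apply norm_sum_le_of_le
          intro i hi
          have hi' : i ≤ n := by have := Finset.mem_range.mp hi; omega
          rw [norm_smul, Real.norm_eq_abs]
          calc |α (i + 1)| * ‖(T ^ (i + 1)) z0‖
              ≤ |α (i + 1)| * (η * (c * ‖(T ^ (i + 1)) z1‖)) := by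
                gcongr; exact hsm i (by omega)
            _ = η * (|α (i + 1)| * (c * ‖(T ^ (i + 1)) z1‖)) := by ring
            _ ≤ _ := mul_le_mul_of_nonneg_left (haj i hi') hη0.le
        rw [Finset.sum_const, Finset.card_range, nsmul_eq_mul] at e2
        rw [Nat.cast_add, Nat.cast_one] at e2
        refine (norm_add_le _ _).trans ((add_le_add e1 e2).trans (le_of_eq ?_))
        rw [← hη]; ring
      rw [hS]
      set E := α 0 • (c • z1) + ∑ i ∈ Finset.range (n + 1), α (i + 1) • (T ^ (i + 1)) z0
      have hSB : 15 / 16 * B ≤ ‖f + α 0 • z0 + E‖ := by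
        have := norm_sub_le (f + α 0 • z0 + E) E
        rw [add_sub_cancel_right] at this
        linarith
      set N := ‖f + α 0 • z0 + E‖
      have hpC : (2 : ℝ) ^ (n + 1 + 2) = 2 * C := by rw [hC]; ring
      rw [hpC]
      have hCN : 15 / 16 * (C * B) ≤ C * N := by
        have := mul_le_mul_of_nonneg_left hSB (by linarith : 0 ≤ C)
        linarith
      have hCB : 4 * B ≤ C * B := by gcongr
      intro j hj
      rcases j with _ | j
      · rw [pow_zero, one_apply_eq_self]
        calc |α 0| * ‖z0 + c • z1‖ ≤ (5 / 2 * B) * (1 + 1 / 16) := by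
              gcongr; linarith
          _ ≤ 2 * C * N := by linarith
      · calc |α (j + 1)| * ‖(T ^ (j + 1)) (z0 + c • z1)‖
            ≤ |α (j + 1)| * ((1 + η) * (c * ‖(T ^ (j + 1)) z1‖)) := by
              gcongr; exact hup j (by omega)
          _ = (1 + η) * (|α (j + 1)| * (c * ‖(T ^ (j + 1)) z1‖)) := by ring
          _ ≤ (1 + 1 / 16) * (3 / 2 * C * B) := by
              exact mul_le_mul (by linarith) (haj j (by omega)) (by positivity) (by norm_num)
          _ ≤ 2 * C * N := by nlinarith [mul_nonneg (by linarith : 0 ≤ C) hB0]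

theorem stmt_16 {X : Type*} [NormedAddCommGroup X] [NormedSpace ℝ X] [CompleteSpace X]
    (hX : ¬ FiniteDimensional ℝ X) (T : X →L[ℝ] X)
    (hT : StrictlySingular T) (hinj : Function.Injective T)
    (Y : Submodule ℝ X) (hYc : IsClosed (Y : Set X)) (hY : ¬ FiniteDimensional ℝ Y)
    (n : ℕ) (hn : 0 < n) :
    ∃ z ∈ Y, ‖z‖ = 1 ∧
      (∀ i, 1 ≤ i → i ≤ n + 1 →
        ‖(T ^ i) z‖ ≤ (1 / ((n : ℝ) ^ 2 * 2 ^ (2 * n + 4))) * ‖(T ^ (i - 1)) z‖) ∧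
      (∀ α : Fin (n + 1) → ℝ,
        ‖∑ i, α i • (‖(T ^ (i : ℕ)) z‖⁻¹ • (T ^ (i : ℕ)) z)‖ = 1 →
        ∀ i, |α i| ≤ (n : ℝ) * 2 ^ (n + 2)) := by
  have hpow : (0 : ℝ) < (n : ℝ) ^ 2 * 2 ^ (2 * n + 4) := by positivity
  obtain ⟨w, hw, hw0, hr, hb⟩ := main_ind T hT hinj n Y hY
    (1 / ((n : ℝ) ^ 2 * 2 ^ (2 * n + 4))) (by positivity)
  have hpos : 0 < ‖w‖ := norm_pos_iff.mpr hw0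
  have hne : ∀ (i : ℕ), (T ^ i) w ≠ 0 := by
    intro i
    induction i with
    | zero => simpa using hw0
    | succ i ih =>
      rw [pow_succ']
      exact fun h => ih (hinj (by simpa using h))
  have hnz : ∀ i, ‖(T ^ i) (‖w‖⁻¹ • w)‖ = ‖w‖⁻¹ * ‖(T ^ i) w‖ := by
    intro i; rw [map_smul, norm_smul, norm_inv, norm_norm]
  refine ⟨‖w‖⁻¹ • w, Y.smul_mem _ hw, by simp [norm_smul, hpos.ne'], ?_, ?_⟩
  · intro i hi hin
    obtain ⟨k, rfl⟩ : ∃ k, i = k + 1 := ⟨i - 1, by omega⟩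
    rw [Nat.add_sub_cancel, hnz, hnz]
    have := mul_le_mul_of_nonneg_left (hr k (by omega)) (inv_nonneg.mpr hpos.le)
    linarith
  · intro α hα i
    let β : ℕ → ℝ := fun k => if h : k < n + 1 then α ⟨k, h⟩ * ‖(T ^ k) w‖⁻¹ else 0
    have hβ : ∀ i : Fin (n + 1), β i = α i * ‖(T ^ (i : ℕ)) w‖⁻¹ := by
      intro i; simp only [β, i.isLt, dif_pos, Fin.eta]
    have hsum : ∑ i ∈ Finset.range (n + 1), β i • (T ^ i) w =
        ∑ i : Fin (n + 1), α i • (‖(T ^ (i : ℕ)) (‖w‖⁻¹ • w)‖⁻¹ • (T ^ (i : ℕ)) (‖w‖⁻¹ • w)) := by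
      rw [Finset.sum_range]
      apply Finset.sum_congr rfl
      intro i _
      rw [hβ, hnz, map_smul, smul_smul, smul_smul]
      congr 1
      have := norm_pos_iff.mpr (hne i)
      field_simp
    have h1 := hb β i (by omega)
    rw [hsum, hα, hβ, abs_mul, abs_inv, abs_norm, mul_assoc,
      inv_mul_cancel₀ (norm_ne_zero_iff.mpr (hne i)), mul_one, mul_one] at h1
    have hn' : (1 : ℝ) ≤ n := by exact_mod_cast hn
    have : (0 : ℝ) < 2 ^ (n + 2) := by positivity
    nlinarith
end
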